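/- arXiv:2604.03054 — 2 statements merged into one kernel-verified Lean document; each statement's English description precedes it below -/
import Mathlib

section
/- The six points A_b, A_c, B_a, B_c, C_a, C_b are concyclic: the circle ω₁ through A' and L tangent to ω at A' meets line BC at A_b, A_c; the circle ω₂ through B' and L tangent to ω at B' meets line CA at B_c, B_a; the circle ω₃ through C' and L tangent to ω at C' meets line AB at C_a, C_b; then these six points lie on a single circle. -/
open EuclideanGeometry RealInnerProductSpace

noncomputable section

abbrev Pt := EuclideanSpace ℝ (Fin 2)

/-- The Lemoine (symmedian) point of a triangle, with barycentric
coordinates `(a², b², c²)`. -/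
noncomputable def lemoinePoint (A B C : Pt) : Pt :=
  ((dist B C) ^ 2 / ((dist B C) ^ 2 + (dist C A) ^ 2 + (dist A B) ^ 2)) • A +
  ((dist C A) ^ 2 / ((dist B C) ^ 2 + (dist C A) ^ 2 + (dist A B) ^ 2)) • B +
  ((dist A B) ^ 2 / ((dist B C) ^ 2 + (dist C A) ^ 2 + (dist A B) ^ 2)) • C

/-- Two circles are tangent at `x`: both pass through `x` and their centers
are collinear with `x` (hence they share the tangent line at `x`). -/
def CircleTangentAt (s t : EuclideanGeometry.Sphere Pt) (x : Pt) : Prop :=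
  x ∈ s ∧ x ∈ t ∧ Collinear ℝ ({s.center, t.center, x} : Set Pt)

/-- The power of a point with respect to a circle. -/
noncomputable def circlePower (p : Pt) (s : EuclideanGeometry.Sphere Pt) : ℝ :=
  dist p s.center ^ 2 - s.radius ^ 2


/-- Vector form of the computation at one vertex, with the circumcenter at the origin. -/
lemma vertex_vec (x y z l x' o P : Pt) (R p q w m t u : ℝ)
    (hx : ⟪x, x⟫ = R) (hy : ⟪y, y⟫ = R) (hz : ⟪z, z⟫ = R)
    (hyz : ⟪y, z⟫ = R - p / 2) (hxz : ⟪x, z⟫ = R - q / 2) (hxy : ⟪x, y⟫ = R - w / 2)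
    (hp : 0 < p) (hq : 0 < q) (hw : 0 < w)
    (hl : l = (p / (p + q + w)) • x + (q / (p + q + w)) • y + (w / (p + q + w)) • z)
    (hx' : x' = x + m • (l - x)) (hm : m ≠ 0) (hx'R : ⟪x', x'⟫ = R)
    (ho : o = t • x')
    (hlo : ⟪l - o, l - o⟫ = ⟪x' - o, x' - o⟫)
    (hP : P = y + u • (z - y))
    (hPo : ⟪P - o, P - o⟫ = ⟪x' - o, x' - o⟫) :
    ⟪P, P⟫ - ⟪P, l⟫ / 2 = R / 2 := by
  have hS : 0 < p + q + w := by positivity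
  have hyx := real_inner_comm y x
  have hzx := real_inner_comm z x
  have hzy := real_inner_comm z y
  have hlx : ⟪l, x⟫ = R - q * w / (p + q + w) := by
    rw [hl]; simp only [inner_add_left, real_inner_smul_left, hx, ← hyx, ← hzx, hxy, hxz]
    field_simp; ring
  have hly : ⟪l, y⟫ = R - p * w / (p + q + w) := by
    rw [hl]; simp only [inner_add_left, real_inner_smul_left, hy, ← hzy, hxy, hyz]
    field_simp; ring
  have hlz : ⟪l, z⟫ = R - p * q / (p + q + w) := by
    rw [hl]; simp only [inner_add_left, real_inner_smul_left, hz, hxz, hyz]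
    field_simp; ring
  have hll : ⟪l, l⟫ = R - 3 * p * q * w / (p + q + w) ^ 2 := by
    have e1 := hlx
    have e2 := hly
    have e3 := hlz
    have h4 : ⟪l, l⟫ = ⟪l, (p / (p + q + w)) • x + (q / (p + q + w)) • y + (w / (p + q + w)) • z⟫ := by
      rw [← hl]
    rw [h4]
    simp only [inner_add_right, real_inner_smul_right, e1, e2, e3]
    field_simp; ring
  have hmN : m * (2 * q + 2 * w - p) = 2 * (p + q + w) := by
    rw [hx'] at hx'R
    simp only [inner_add_left, inner_add_right, inner_sub_left, inner_sub_right,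
      real_inner_smul_left, real_inner_smul_right] at hx'R
    have e1 := hlx
    rw [real_inner_comm] at e1
    rw [hll, hlx, e1, hx] at hx'R
    field_simp at hx'R
    have : (m * q * w) * (m * (2 * q + 2 * w - p) - 2 * (p + q + w)) = 0 := by
      linear_combination hx'R
    have h2 := (mul_eq_zero.1 this).resolve_left (by positivity)
    linarith
  have hx'y : ⟪x', y⟫ = R - w / 2 + m * (w / 2 - p * w / (p + q + w)) := by
    rw [hx']; simp only [inner_add_left, inner_sub_left, real_inner_smul_left, hly, hxy]; ring
  have hx'z : ⟪x', z⟫ = R - q / 2 + m * (q / 2 - p * q / (p + q + w)) := by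
    rw [hx']; simp only [inner_add_left, inner_sub_left, real_inner_smul_left, hlz, hxz]; ring
  have e1 := hlx
  rw [real_inner_comm] at e1
  have hx'l : ⟪x', l⟫ = R - q * w / (p + q + w)
      + m * (q * w / (p + q + w) - 3 * p * q * w / (p + q + w) ^ 2) := by
    rw [hx']; simp only [inner_add_left, inner_sub_left, real_inner_smul_left, hll, e1]; ring
  have hx'l2 := hx'l
  rw [real_inner_comm] at hx'l2
  have hlo' : ⟪l, l⟫ - R = 2 * t * (⟪x', l⟫ - R) := by
    rw [ho] at hlo
    simp only [inner_sub_left, inner_sub_right,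
      real_inner_smul_left, real_inner_smul_right, hx'R, real_inner_comm x' l] at hlo
    linarith
  have hPo' : ⟪P, P⟫ - R = 2 * t * (⟪x', P⟫ - R) := by
    rw [ho] at hPo
    simp only [inner_sub_left, inner_sub_right,
      real_inner_smul_left, real_inner_smul_right, hx'R, real_inner_comm x' P] at hPo
    linarith
  have htm : t * m = 1 := by
    rw [hll, hx'l] at hlo'
    have h : -3 * p * q * w = 2 * t * (-(q * w * (p + q + w))
        + m * (q * w * (p + q + w) - 3 * p * q * w)) := by
      field_simp at hlo'
      linear_combination hlo'
    have : (p * q * w) * (t * m - 1) = 0 := by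
      linear_combination h / 3 + (t * q * w / 3) * hmN
    have h2 := (mul_eq_zero.1 this).resolve_left (by positivity)
    linarith
  have hx'P : ⟪x', P⟫ = (1 - u) * ⟪x', y⟫ + u * ⟪x', z⟫ := by
    rw [hP]; simp only [inner_add_right, inner_sub_right, real_inner_smul_right]; ring
  have hlP : ⟪P, l⟫ = (1 - u) * ⟪l, y⟫ + u * ⟪l, z⟫ := by
    rw [real_inner_comm, hP]
    simp only [inner_add_right, inner_sub_right, real_inner_smul_right]; ring
  rw [hx'P, hx'y, hx'z] at hPo'
  rw [hlP, hly, hlz]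
  have ht : t = (2 * q + 2 * w - p) / 2 * (p + q + w)⁻¹ := by
    field_simp
    linear_combination (2 * q + 2 * w - p) * htm - t * hmN
  have hSi : (p + q + w) * (p + q + w)⁻¹ = 1 := mul_inv_cancel₀ hS.ne'
  simp only [div_eq_mul_inv _ (p + q + w)] at hPo' ⊢
  linear_combination hPo' + 2 * ((1 - u) * (w / 2 - p * w * (p + q + w)⁻¹)
    + u * (q / 2 - p * q * (p + q + w)⁻¹)) * htm - ((1 - u) * w + u * q) * ht
    - ((1 - u) * w + u * q) * hSi

lemma vertex_pt (A B C L A' P : Pt) (ω ω₁ : EuclideanGeometry.Sphere Pt) (hr : 0 < ω.radius)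
    (hAB : A ≠ B) (hBC : B ≠ C) (hCA : C ≠ A)
    (hA : A ∈ ω) (hB : B ∈ ω) (hC : C ∈ ω) (hL : L = lemoinePoint A B C)
    (hA' : A' ∈ ω) (hne : A' ≠ A) (hcol : Collinear ℝ ({A, L, A'} : Set Pt))
    (h1 : A' ∈ ω₁) (h2 : L ∈ ω₁) (ht : CircleTangentAt ω₁ ω A')
    (hP : P ∈ ω₁) (hPl : P ∈ affineSpan ℝ ({B, C} : Set Pt)) :
    ⟪P - ω.center, P - ω.center⟫ - ⟪P - ω.center, L - ω.center⟫ / 2 = ω.radius ^ 2 / 2 := by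
  obtain ⟨-, -, ht⟩ := ht
  have hp : 0 < dist B C ^ 2 := by have := dist_pos.2 hBC; positivity
  have hq : 0 < dist C A ^ 2 := by have := dist_pos.2 hCA; positivity
  have hw : 0 < dist A B ^ 2 := by have := dist_pos.2 hAB; positivity
  have mem (s : EuclideanGeometry.Sphere Pt) (X : Pt) (h : X ∈ s) :
      ⟪X - s.center, X - s.center⟫ = s.radius ^ 2 := by
    rw [real_inner_self_eq_norm_sq, ← dist_eq_norm, EuclideanGeometry.mem_sphere.1 h]
  have pair (X Y : Pt) (hX : X ∈ ω) (hY : Y ∈ ω) :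
      ⟪X - ω.center, Y - ω.center⟫ = ω.radius ^ 2 - dist X Y ^ 2 / 2 := by
    have e1 := mem ω X hX
    have e2 := mem ω Y hY
    have e3 : dist X Y ^ 2 = ⟪(X - ω.center) - (Y - ω.center), (X - ω.center) - (Y - ω.center)⟫ := by
      rw [sub_sub_sub_cancel_right, real_inner_self_eq_norm_sq, dist_eq_norm]
    rw [real_inner_sub_sub_self] at e3
    linarith
  have hAC := pair A C hA hC
  rw [dist_comm A C] at hAC
  have hl : L - ω.center =
      (dist B C ^ 2 / (dist B C ^ 2 + dist C A ^ 2 + dist A B ^ 2)) • (A - ω.center) +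
      (dist C A ^ 2 / (dist B C ^ 2 + dist C A ^ 2 + dist A B ^ 2)) • (B - ω.center) +
      (dist A B ^ 2 / (dist B C ^ 2 + dist C A ^ 2 + dist A B ^ 2)) • (C - ω.center) := by
    have h1 : dist B C ^ 2 / (dist B C ^ 2 + dist C A ^ 2 + dist A B ^ 2) +
      dist C A ^ 2 / (dist B C ^ 2 + dist C A ^ 2 + dist A B ^ 2) +
      dist A B ^ 2 / (dist B C ^ 2 + dist C A ^ 2 + dist A B ^ 2) = 1 := by
      field_simp
    rw [hL, lemoinePoint]
    generalize dist B C ^ 2 / (dist B C ^ 2 + dist C A ^ 2 + dist A B ^ 2) = a at *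
    generalize dist C A ^ 2 / (dist B C ^ 2 + dist C A ^ 2 + dist A B ^ 2) = b at *
    generalize dist A B ^ 2 / (dist B C ^ 2 + dist C A ^ 2 + dist A B ^ 2) = c at *
    have : c = 1 - a - b := by linarith
    subst this
    module
  have hLA : L ≠ A := by
    intro h
    have e := mem ω A hA
    have e2 : ⟪L - ω.center, A - ω.center⟫ = ω.radius ^ 2 := by rw [h, e]
    rw [hl] at e2
    have f1 := pair B A hB hA
    have f2 := pair C A hC hA
    rw [dist_comm B A] at f1
    simp only [inner_add_left, real_inner_smul_left, e, f1, f2] at e2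
    field_simp at e2
    nlinarith [mul_pos hq hw]
  have hO : ω.center ≠ A' := by
    rintro h
    have := EuclideanGeometry.mem_sphere.1 hA'
    rw [h, dist_self] at this
    linarith
  have hm : ∃ m : ℝ, A' = A + m • (L - A) := by
    have := hcol.mem_affineSpan_of_mem_of_ne (p₁ := A) (p₂ := L) (p₃ := A')
      (by simp) (by simp) (by simp) hLA.symm
    obtain ⟨m, hm⟩ := mem_affineSpan_pair_iff_exists_lineMap_eq.1 this
    refine ⟨m, ?_⟩
    rw [← hm, AffineMap.lineMap_apply, vsub_eq_sub, vadd_eq_add, add_comm]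
  have hk : ∃ t : ℝ, ω₁.center = ω.center + t • (A' - ω.center) := by
    have := ht.mem_affineSpan_of_mem_of_ne (p₁ := ω.center) (p₂ := A') (p₃ := ω₁.center)
      (by simp) (by simp) (by simp) hO
    obtain ⟨m, hm⟩ := mem_affineSpan_pair_iff_exists_lineMap_eq.1 this
    refine ⟨m, ?_⟩
    rw [← hm, AffineMap.lineMap_apply, vsub_eq_sub, vadd_eq_add, add_comm]
  have hu : ∃ u : ℝ, P = B + u • (C - B) := by
    obtain ⟨m, hm⟩ := mem_affineSpan_pair_iff_exists_lineMap_eq.1 hPl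
    refine ⟨m, ?_⟩
    rw [← hm, AffineMap.lineMap_apply, vsub_eq_sub, vadd_eq_add, add_comm]
  obtain ⟨m, hm⟩ := hm
  obtain ⟨t, hk⟩ := hk
  obtain ⟨u, hu⟩ := hu
  refine vertex_vec (A - ω.center) (B - ω.center) (C - ω.center) (L - ω.center) (A' - ω.center)
    (ω₁.center - ω.center) (P - ω.center) (ω.radius ^ 2) (dist B C ^ 2) (dist C A ^ 2)
    (dist A B ^ 2) m t u (mem ω A hA) (mem ω B hB) (mem ω C hC) (pair B C hB hC) hAC
    (pair A B hA hB) hp hq hw hl ?_ ?_ (mem ω A' hA') ?_ ?_ ?_ ?_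
  · rw [hm]; module
  · rintro rfl
    apply hne
    rw [hm]; simp
  · rw [hk]; module
  · simp only [sub_sub_sub_cancel_right]
    rw [mem ω₁ L h2, mem ω₁ A' h1]
  · rw [hu]; module
  · simp only [sub_sub_sub_cancel_right]
    rw [mem ω₁ P hP, mem ω₁ A' h1]

lemma lemoine_rot (A B C : Pt) : lemoinePoint A B C = lemoinePoint B C A := by
  unfold lemoinePoint
  rw [show dist C A ^ 2 + dist A B ^ 2 + dist B C ^ 2
    = dist B C ^ 2 + dist C A ^ 2 + dist A B ^ 2 by ring]
  abel

lemma mem_final (P O L : Pt) (R : ℝ)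
    (h : ⟪P - O, P - O⟫ - ⟪P - O, L - O⟫ / 2 = R / 2) :
    P ∈ (⟨O + (1 / 4 : ℝ) • (L - O), √(R / 2 + ⟪L - O, L - O⟫ / 16)⟩ :
      EuclideanGeometry.Sphere Pt) := by
  rw [EuclideanGeometry.mem_sphere]
  simp only
  rw [dist_eq_norm, ← sub_sub, ← Real.sqrt_sq (norm_nonneg _), ← real_inner_self_eq_norm_sq,
    real_inner_sub_sub_self, real_inner_smul_right, real_inner_smul_right, real_inner_smul_left]
  congr 1
  linarith

theorem stmt6    (A B C : Pt) (hABC : AffineIndependent ℝ ![A, B, C])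
    (ω : EuclideanGeometry.Sphere Pt) (hr : 0 < ω.radius)
    (hA : A ∈ ω) (hB : B ∈ ω) (hC : C ∈ ω)
    (L : Pt) (hL : L = lemoinePoint A B C)
    (A' : Pt) (hA'w : A' ∈ ω) (hA'ne : A' ≠ A) (hA'col : Collinear ℝ ({A, L, A'} : Set Pt))
    (B' : Pt) (hB'w : B' ∈ ω) (hB'ne : B' ≠ B) (hB'col : Collinear ℝ ({B, L, B'} : Set Pt))
    (C' : Pt) (hC'w : C' ∈ ω) (hC'ne : C' ≠ C) (hC'col : Collinear ℝ ({C, L, C'} : Set Pt))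
    (ω₁ : EuclideanGeometry.Sphere Pt) (hω₁1 : A' ∈ ω₁) (hω₁2 : L ∈ ω₁)
    (hω₁t : CircleTangentAt ω₁ ω A')
    (A_b A_c : Pt) (hA_bA_c : A_b ≠ A_c)
    (hA_bc : A_b ∈ ω₁) (hA_bl : A_b ∈ affineSpan ℝ ({B, C} : Set Pt))
    (hA_cc : A_c ∈ ω₁) (hA_cl : A_c ∈ affineSpan ℝ ({B, C} : Set Pt))
    (ω₂ : EuclideanGeometry.Sphere Pt) (hω₂1 : B' ∈ ω₂) (hω₂2 : L ∈ ω₂)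
    (hω₂t : CircleTangentAt ω₂ ω B')
    (B_c B_a : Pt) (hB_cB_a : B_c ≠ B_a)
    (hB_cc : B_c ∈ ω₂) (hB_cl : B_c ∈ affineSpan ℝ ({C, A} : Set Pt))
    (hB_ac : B_a ∈ ω₂) (hB_al : B_a ∈ affineSpan ℝ ({C, A} : Set Pt))
    (ω₃ : EuclideanGeometry.Sphere Pt) (hω₃1 : C' ∈ ω₃) (hω₃2 : L ∈ ω₃)
    (hω₃t : CircleTangentAt ω₃ ω C')
    (C_a C_b : Pt) (hC_aC_b : C_a ≠ C_b)
    (hC_ac : C_a ∈ ω₃) (hC_al : C_a ∈ affineSpan ℝ ({A, B} : Set Pt))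
    (hC_bc : C_b ∈ ω₃) (hC_bl : C_b ∈ affineSpan ℝ ({A, B} : Set Pt))
    : ∃ s : EuclideanGeometry.Sphere Pt, A_b ∈ s ∧ A_c ∈ s ∧ B_a ∈ s ∧ B_c ∈ s ∧ C_a ∈ s ∧ C_b ∈ s := by 
  have hAB : A ≠ B := fun h => absurd (hABC.injective (a₁ := 0) (a₂ := 1) (by simpa using h)) (by decide)
  have hBC : B ≠ C := fun h => absurd (hABC.injective (a₁ := 1) (a₂ := 2) (by simpa using h)) (by decide)
  have hCA : C ≠ A := fun h => absurd (hABC.injective (a₁ := 2) (a₂ := 0) (by simpa using h)) (by decide)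
  have hL2 : L = lemoinePoint B C A := hL.trans (lemoine_rot A B C)
  have hL3 : L = lemoinePoint C A B := hL2.trans (lemoine_rot B C A)
  refine ⟨_, mem_final A_b ω.center L (ω.radius ^ 2) ?_, mem_final A_c ω.center L _ ?_,
    mem_final B_a ω.center L _ ?_, mem_final B_c ω.center L _ ?_,
    mem_final C_a ω.center L _ ?_, mem_final C_b ω.center L _ ?_⟩
  · exact vertex_pt A B C L A' A_b ω ω₁ hr hAB hBC hCA hA hB hC hL hA'w hA'ne hA'col
      hω₁1 hω₁2 hω₁t hA_bc hA_bl
  · exact vertex_pt A B C L A' A_c ω ω₁ hr hAB hBC hCA hA hB hC hL hA'w hA'ne hA'col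
      hω₁1 hω₁2 hω₁t hA_cc hA_cl
  · exact vertex_pt B C A L B' B_a ω ω₂ hr hBC hCA hAB hB hC hA hL2 hB'w hB'ne hB'col
      hω₂1 hω₂2 hω₂t hB_ac hB_al
  · exact vertex_pt B C A L B' B_c ω ω₂ hr hBC hCA hAB hB hC hA hL2 hB'w hB'ne hB'col
      hω₂1 hω₂2 hω₂t hB_cc hB_cl
  · exact vertex_pt C A B L C' C_a ω ω₃ hr hCA hAB hBC hC hA hB hL3 hC'w hC'ne hC'col
      hω₃1 hω₃2 hω₃t hC_ac hC_al
  · exact vertex_pt C A B L C' C_b ω ω₃ hr hCA hAB hBC hC hA hB hL3 hC'w hC'ne hC'col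
      hω₃1 hω₃2 hω₃t hC_bc hC_bl
end
end

section
/- (Q.T. Bui Circle) Let ω₁ be the circle through A and L tangent to the circumcircle ω at A, meeting lines AB and AC again at A_b and A_c; define ω₂, ω₃ and points B_c, B_a, C_a, C_b analogously at vertices B and C. Then the six points A_b, A_c, B_a, B_c, C_a, C_b are concyclic, and the center M of their circle satisfies M - L = (1/4)(O - L) as vectors. -/
open EuclideanGeometry RealInnerProductSpace

noncomputable section

/-- Vector form with the circumcenter as origin. -/
lemma key_vec (u v w l x : Pt) (r a b c k t S : ℝ) (huu : ⟪u, u⟫ = r) (hvv : ⟪v, v⟫ = r)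
    (hww : ⟪w, w⟫ = r) (ha : ⟪v, w⟫ = r - a / 2) (hb : ⟪u, w⟫ = r - b / 2)
    (hc : ⟪u, v⟫ = r - c / 2) (hb0 : b ≠ 0) (hc0 : c ≠ 0) (hS : S = a + b + c) (hS0 : S ≠ 0)
    (hl : S • l = a • u + b • v + c • w) (hx : x = u + t • (v - u)) (ht : t ≠ 0)
    (h1 : ⟪x - (1 - k) • u, x - (1 - k) • u⟫ = k ^ 2 * r)
    (h2 : ⟪l - (1 - k) • u, l - (1 - k) • u⟫ = k ^ 2 * r) :
    ⟪x - (3 / 4 : ℝ) • l, x - (3 / 4 : ℝ) • l⟫ = r / 16 + 9 * (a * b * c) / (16 * S ^ 2) := by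
  have ha' : ⟪w, v⟫ = r - a / 2 := by rw [real_inner_comm]; exact ha
  have hb' : ⟪w, u⟫ = r - b / 2 := by rw [real_inner_comm]; exact hb
  have hc' : ⟪v, u⟫ = r - c / 2 := by rw [real_inner_comm]; exact hc
  have hlu : S * ⟪l, u⟫ = S * r - b * c := by
    have h : ⟪S • l, u⟫ = ⟪a • u + b • v + c • w, u⟫ := by rw [hl]
    simp only [inner_add_left, real_inner_smul_left, huu, hb', hc'] at h
    rw [h, hS]; ring
  have hlv : S * ⟪l, v⟫ = S * r - a * c := by
    have h : ⟪S • l, v⟫ = ⟪a • u + b • v + c • w, v⟫ := by rw [hl]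
    simp only [inner_add_left, real_inner_smul_left, hvv, ha', hc] at h
    rw [h, hS]; ring
  have hlw : S * ⟪l, w⟫ = S * r - a * b := by
    have h : ⟪S • l, w⟫ = ⟪a • u + b • v + c • w, w⟫ := by rw [hl]
    simp only [inner_add_left, real_inner_smul_left, hww, ha, hb] at h
    rw [h, hS]; ring
  have hll : S ^ 2 * ⟪l, l⟫ = S ^ 2 * r - 3 * (a * b * c) := by
    have h : ⟪l, S • l⟫ = ⟪l, a • u + b • v + c • w⟫ := by rw [hl]
    simp only [inner_add_right, real_inner_smul_right] at h
    linear_combination S * h + a * hlu + b * hlv + c * hlw - S * r * hS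
  have hul : ⟪u, l⟫ = ⟪l, u⟫ := real_inner_comm _ _
  have hvl : ⟪v, l⟫ = ⟪l, v⟫ := real_inner_comm _ _
  have htk : t = k := by
    subst hx
    simp only [inner_add_left, inner_add_right, inner_sub_left, inner_sub_right,
      real_inner_smul_left, real_inner_smul_right, huu, hvv, hc, hc'] at h1
    have : t * c * (t - k) = 0 := by linear_combination h1
    rcases mul_eq_zero.1 this with h | h
    · exact absurd h (mul_ne_zero ht hc0)
    · linarith
  have hk : 2 * S * (1 - k) = 3 * a := by
    simp only [inner_sub_left, inner_sub_right,
      real_inner_smul_left, real_inner_smul_right, huu, hul] at h2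
    have : b * c * (2 * S * (1 - k) - 3 * a) = 0 := by
      linear_combination S ^ 2 * h2 - hll + 2 * S * (1 - k) * hlu
    rcases mul_eq_zero.1 this with h | h
    · exact absurd h (mul_ne_zero hb0 hc0)
    · linarith
  subst hx htk
  have e : r / 16 + 9 * (a * b * c) / (16 * S ^ 2)
      = (S ^ 2 * r + 9 * (a * b * c)) / (16 * S ^ 2) := by field_simp
  rw [e, eq_div_iff (by positivity)]
  have hxl : ⟪l, u + t • (v - u)⟫ = ⟪u + t • (v - u), l⟫ := real_inner_comm _ _
  simp only [inner_add_left, inner_add_right, inner_sub_left, inner_sub_right,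
      real_inner_smul_left, real_inner_smul_right, huu, hvv, hc, hc', hul, hvl]
  linear_combination 9 * hll - 24 * S * (1 - t) * hlu - 24 * S * t * hlv +
    (-8 * S * t * c + 12 * b * c) * hk

lemma key (A B C O L P X : Pt) (r ρ : ℝ) (hr : 0 < r)
    (hA : dist A O = r) (hB : dist B O = r) (hC : dist C O = r)
    (hAB : A ≠ B) (hAC : A ≠ C) (hL : L = lemoinePoint A B C)
    (hAP : dist A P = ρ) (hLP : dist L P = ρ) (hXP : dist X P = ρ)
    (hcol : Collinear ℝ ({P, O, A} : Set Pt)) (hX : X ∈ affineSpan ℝ ({A, B} : Set Pt))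
    (hXA : X ≠ A) :
    dist X (L + (1 / 4 : ℝ) • (O - L)) ^ 2 = r ^ 2 / 16 +
      9 * (dist B C ^ 2 * dist C A ^ 2 * dist A B ^ 2) /
        (16 * (dist B C ^ 2 + dist C A ^ 2 + dist A B ^ 2) ^ 2) := by
  have hOA : O ≠ A := by
    rintro rfl
    simp at hA; linarith
  obtain ⟨k, hk⟩ : ∃ k : ℝ, P - O = (1 - k) • (A - O) := by
    obtain ⟨d, hd⟩ := (collinear_iff_of_mem (p₀ := A) (by simp)).1 hcol
    obtain ⟨p, hp⟩ := hd P (by simp)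
    obtain ⟨s, hs⟩ := hd O (by simp)
    simp only [vadd_eq_add] at hp hs
    have hs0 : s ≠ 0 := by
      rintro rfl
      simp at hs; exact hOA hs
    refine ⟨p / s, ?_⟩
    have h1 : P - O = (p - s) • d := by rw [hp, hs]; module
    have h2 : A - O = (-s) • d := by rw [hs]; module
    rw [h1, h2, smul_smul]
    congr 1
    field_simp
    ring
  obtain ⟨t, ht⟩ := mem_affineSpan_pair_iff_exists_lineMap_eq.1 hX
  have htX : X - O = (A - O) + t • ((B - O) - (A - O)) := by
    rw [← ht, AffineMap.lineMap_apply]; simp only [vsub_eq_sub, vadd_eq_add]; module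
  have ht0 : t ≠ 0 := by
    rintro rfl
    simp at ht; exact hXA ht.symm
  have dsq : ∀ p q : Pt, dist p q ^ 2 = ⟪p - q, p - q⟫ := fun p q => by
    rw [dist_eq_norm, real_inner_self_eq_norm_sq]
  have dO : ∀ p q : Pt, dist p O = r → dist q O = r →
      ⟪p - O, q - O⟫ = r ^ 2 - dist p q ^ 2 / 2 := fun p q hp hq => by
    have e : p - q = (p - O) - (q - O) := by abel
    have h1 := dsq p O
    have h2 := dsq q O
    rw [hp] at h1
    rw [hq] at h2
    rw [dsq p q, e]
    generalize p - O = y at *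
    generalize q - O = z at *
    rw [inner_sub_left, inner_sub_right, inner_sub_right, real_inner_comm y z]
    linarith
  have hAB' : 0 < dist A B := dist_pos.2 hAB
  have hCA' : 0 < dist C A := dist_pos.2 hAC.symm
  have hS0 : dist B C ^ 2 + dist C A ^ 2 + dist A B ^ 2 ≠ 0 := by positivity
  have hρ : ρ ^ 2 = k ^ 2 * r ^ 2 := by
    have e : A - P = k • (A - O) := by
      have : A - P = (A - O) - (P - O) := by abel
      rw [this, hk]; module
    rw [← hAP, dsq, e, real_inner_smul_left, real_inner_smul_right, ← dsq, hA]; ring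
  have eP : ∀ Y : Pt, dist Y P = ρ →
      ⟪(Y - O) - (1 - k) • (A - O), (Y - O) - (1 - k) • (A - O)⟫ = k ^ 2 * r ^ 2 := fun Y hY => by
    rw [← hk, sub_sub_sub_cancel_right, ← dsq, hY, hρ]
  have hM : X - (L + (1 / 4 : ℝ) • (O - L)) = (X - O) - (3 / 4 : ℝ) • (L - O) := by module
  rw [dsq, hM]
  refine key_vec (A - O) (B - O) (C - O) (L - O) (X - O) (r ^ 2) (dist B C ^ 2) (dist C A ^ 2)
    (dist A B ^ 2) k t _ ?_ ?_ ?_ (dO _ _ hB hC) ?_ (dO _ _ hA hB) (by positivity) (by positivity)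
    rfl hS0 ?_ htX ht0 (eP X hXP) (eP L hLP)
  · rw [← dsq, hA]
  · rw [← dsq, hB]
  · rw [← dsq, hC]
  · rw [dist_comm C A]; exact dO _ _ hA hC
  · rw [hL, lemoinePoint]
    generalize dist B C ^ 2 = a at *
    generalize dist C A ^ 2 = b at *
    generalize dist A B ^ 2 = c at *
    rw [smul_sub, smul_add, smul_add, smul_smul, smul_smul, smul_smul, mul_div_cancel₀ _ hS0,
      mul_div_cancel₀ _ hS0, mul_div_cancel₀ _ hS0]
    module

lemma lemoine_swap (A B C : Pt) : lemoinePoint A B C = lemoinePoint A C B := by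
  simp only [lemoinePoint, dist_comm C B, dist_comm B A, dist_comm A C]
  rw [add_right_comm (dist B C ^ 2)]
  abel

theorem stmt13    (A B C : Pt) (hABC : AffineIndependent ℝ ![A, B, C])
    (ω : EuclideanGeometry.Sphere Pt) (hr : 0 < ω.radius)
    (hA : A ∈ ω) (hB : B ∈ ω) (hC : C ∈ ω)
    (L : Pt) (hL : L = lemoinePoint A B C)
    (ω₁ : EuclideanGeometry.Sphere Pt) (hω₁1 : A ∈ ω₁) (hω₁2 : L ∈ ω₁)
    (hω₁t : CircleTangentAt ω₁ ω A)
    (A_b : Pt) (hA_bc : A_b ∈ ω₁) (hA_bl : A_b ∈ affineSpan ℝ ({A, B} : Set Pt)) (hA_bne : A_b ≠ A)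
    (A_c : Pt) (hA_cc : A_c ∈ ω₁) (hA_cl : A_c ∈ affineSpan ℝ ({A, C} : Set Pt)) (hA_cne : A_c ≠ A)
    (ω₂ : EuclideanGeometry.Sphere Pt) (hω₂1 : B ∈ ω₂) (hω₂2 : L ∈ ω₂)
    (hω₂t : CircleTangentAt ω₂ ω B)
    (B_c : Pt) (hB_cc : B_c ∈ ω₂) (hB_cl : B_c ∈ affineSpan ℝ ({B, C} : Set Pt)) (hB_cne : B_c ≠ B)
    (B_a : Pt) (hB_ac : B_a ∈ ω₂) (hB_al : B_a ∈ affineSpan ℝ ({B, A} : Set Pt)) (hB_ane : B_a ≠ B)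
    (ω₃ : EuclideanGeometry.Sphere Pt) (hω₃1 : C ∈ ω₃) (hω₃2 : L ∈ ω₃)
    (hω₃t : CircleTangentAt ω₃ ω C)
    (C_a : Pt) (hC_ac : C_a ∈ ω₃) (hC_al : C_a ∈ affineSpan ℝ ({C, A} : Set Pt)) (hC_ane : C_a ≠ C)
    (C_b : Pt) (hC_bc : C_b ∈ ω₃) (hC_bl : C_b ∈ affineSpan ℝ ({C, B} : Set Pt)) (hC_bne : C_b ≠ C)
    : ∃ s : EuclideanGeometry.Sphere Pt, (A_b ∈ s ∧ A_c ∈ s ∧ B_a ∈ s ∧ B_c ∈ s ∧ C_a ∈ s ∧ C_b ∈ s) ∧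
      s.center - L = (1 / 4 : ℝ) • (ω.center - L) := by
  have hAB : A ≠ B := fun h => by simpa using hABC.injective.ne (show (0 : Fin 3) ≠ 1 by decide) (by simpa using h)
  have hAC : A ≠ C := fun h => by simpa using hABC.injective.ne (show (0 : Fin 3) ≠ 2 by decide) (by simpa using h)
  have hBC : B ≠ C := fun h => by simpa using hABC.injective.ne (show (1 : Fin 3) ≠ 2 by decide) (by simpa using h)
  have l1 : L = lemoinePoint A C B := by rw [hL, lemoine_swap]
  have l2 : L = lemoinePoint B C A := by rw [hL, lemoine_rot]
  have l3 : L = lemoinePoint B A C := by rw [l2, lemoine_swap]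
  have l4 : L = lemoinePoint C A B := by rw [l2, lemoine_rot]
  have l5 : L = lemoinePoint C B A := by rw [l4, lemoine_swap]
  have k1 := key A B C ω.center L ω₁.center A_b _ _ hr hA hB hC hAB hAC hL hω₁1 hω₁2 hA_bc
    hω₁t.2.2 hA_bl hA_bne
  have k2 := key A C B ω.center L ω₁.center A_c _ _ hr hA hC hB hAC hAB l1 hω₁1 hω₁2 hA_cc
    hω₁t.2.2 hA_cl hA_cne
  have k3 := key B A C ω.center L ω₂.center B_a _ _ hr hB hA hC hAB.symm hBC l3 hω₂1 hω₂2 hB_ac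
    hω₂t.2.2 hB_al hB_ane
  have k4 := key B C A ω.center L ω₂.center B_c _ _ hr hB hC hA hBC hAB.symm l2 hω₂1 hω₂2 hB_cc
    hω₂t.2.2 hB_cl hB_cne
  have k5 := key C A B ω.center L ω₃.center C_a _ _ hr hC hA hB hAC.symm hBC.symm l4 hω₃1 hω₃2
    hC_ac hω₃t.2.2 hC_al hC_ane
  have k6 := key C B A ω.center L ω₃.center C_b _ _ hr hC hB hA hBC.symm hAC.symm l5 hω₃1 hω₃2
    hC_bc hω₃t.2.2 hC_bl hC_bne
  have fin : ∀ (X : Pt) (q : ℝ), dist X (L + (1 / 4 : ℝ) • (ω.center - L)) ^ 2 = q →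
      q = ω.radius ^ 2 / 16 + 9 * (dist B C ^ 2 * dist C A ^ 2 * dist A B ^ 2) /
        (16 * (dist B C ^ 2 + dist C A ^ 2 + dist A B ^ 2) ^ 2) →
      X ∈ (⟨L + (1 / 4 : ℝ) • (ω.center - L), √(ω.radius ^ 2 / 16 +
        9 * (dist B C ^ 2 * dist C A ^ 2 * dist A B ^ 2) /
        (16 * (dist B C ^ 2 + dist C A ^ 2 + dist A B ^ 2) ^ 2))⟩ : EuclideanGeometry.Sphere Pt) := by
    intro X q h1 h2
    rw [EuclideanGeometry.mem_sphere]
    rw [← h2, ← h1, Real.sqrt_sq dist_nonneg]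
  refine ⟨_, ⟨fin _ _ k1 ?_, fin _ _ k2 ?_, fin _ _ k3 ?_, fin _ _ k4 ?_, fin _ _ k5 ?_,
    fin _ _ k6 ?_⟩, ?_⟩
  rotate_right
  · simp only [add_sub_cancel_left]
  all_goals
    try simp only [dist_comm C B, dist_comm B A, dist_comm A C]
    try ring
end
end
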